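/- Let H be a Hilbert space and A, B ∈ B(H) compact operators. Then for every n ≥ 1, hₙ(M_{A,B}) ≥ (s(A) ⊗ s(B))ₙ / √n, where M_{A,B} : B(H) → B(H) is X ↦ A X B. -/

import Mathlib

open scoped BigOperators

noncomputable section

/-- The space of complex null sequences `c₀`. -/
def c0 : Set (ℕ → ℂ) := {α | Filter.Tendsto α Filter.atTop (nhds 0)}

/-- `rearrSum α n` is the supremum of `∑_{i ∈ F} |α i|` over finite sets `F ⊆ ℕ` with
`|F| = n`; for a null sequence it equals `α*₁ + ⋯ + α*ₙ` where `α*` is the decreasing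
rearrangement of `(|α_n|)`. -/
def rearrSum (α : ℕ → ℂ) (n : ℕ) : ℝ :=
  sSup ((fun F : Finset ℕ => ∑ i ∈ F, ‖α i‖) '' {F | F.card = n})

/-- The decreasing rearrangement of a null sequence, 0-indexed:
`rearr α n = α*_{n+1}`. -/
def rearr (α : ℕ → ℂ) (n : ℕ) : ℝ := rearrSum α (n + 1) - rearrSum α n

/-- A Calkin space: a linear subspace of `c₀` containing every null sequence whose
decreasing rearrangement is dominated termwise by that of one of its members. -/
def IsCalkinSpace (I : Set (ℕ → ℂ)) : Prop :=
  I ⊆ c0 ∧ (0 : ℕ → ℂ) ∈ I ∧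
  (∀ α ∈ I, ∀ β ∈ I, α + β ∈ I) ∧
  (∀ (c : ℂ), ∀ α ∈ I, c • α ∈ I) ∧
  (∀ α ∈ I, ∀ β ∈ c0, (∀ n, rearr β n ≤ rearr α n) → β ∈ I)

/-- `tensorSum α β n` is the supremum of `∑_{(i,j) ∈ F} |α i| |β j|` over finite
`F ⊆ ℕ × ℕ` with `|F| = n`; it equals `(α⊗β)₁ + ⋯ + (α⊗β)ₙ`. -/
def tensorSum (α β : ℕ → ℂ) (n : ℕ) : ℝ :=
  sSup ((fun F : Finset (ℕ × ℕ) => ∑ p ∈ F, ‖α p.1‖ * ‖β p.2‖) '' {F | F.card = n})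

/-- The tensor sequence `α⊗β`: the decreasing rearrangement of the double sequence
`(|α_m β_n|)_{m,n}`, 0-indexed: `tensorSeq α β n = (α⊗β)_{n+1}`. -/
def tensorSeq (α β : ℕ → ℂ) (n : ℕ) : ℝ := tensorSum α β (n + 1) - tensorSum α β n

/-- Embedding of real sequences into complex sequences. -/
def toC (f : ℕ → ℝ) : ℕ → ℂ := fun n => (f n : ℂ)

/-- The tensor product `𝔦⊗𝔧` of two Calkin spaces: the smallest Calkin space
containing `α⊗β` for all `α ∈ 𝔦`, `β ∈ 𝔧`. -/
def calkinTensor (I J : Set (ℕ → ℂ)) : Set (ℕ → ℂ) :=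
  ⋂₀ {K | IsCalkinSpace K ∧ ∀ α ∈ I, ∀ β ∈ J, toC (tensorSeq α β) ∈ K}

/-- A Calkin space `𝔦` is stable if `𝔦⊗𝔦 = 𝔦`. -/
def IsStableCalkin (I : Set (ℕ → ℂ)) : Prop := IsCalkinSpace I ∧ calkinTensor I I = I

/-- The principal Calkin space `⟨α⟩` generated by `α`: the smallest Calkin space
containing `α`. -/
def principalCalkin (α : ℕ → ℂ) : Set (ℕ → ℂ) := ⋂₀ {K | IsCalkinSpace K ∧ α ∈ K}

/-- `Kw ω α n = #{m : ω^{n+1} < α m ≤ ω^n}` (the sequence `α` being 0-indexed). -/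
def Kw (ω : ℝ) (α : ℕ → ℝ) (n : ℕ) : ℕ :=
  Set.ncard {m : ℕ | ω ^ (n + 1) < α m ∧ α m ≤ ω ^ n}

/-- `K̃ₙ = Σ_{i=0}^n Kᵢ`. -/
def Ktil (ω : ℝ) (α : ℕ → ℝ) (n : ℕ) : ℕ := ∑ i ∈ Finset.range (n + 1), Kw ω α i

/-- `Mₙ = Σ_{i+j=n} Kᵢ Kⱼ`. -/
def Mw (ω : ℝ) (α : ℕ → ℝ) (n : ℕ) : ℕ :=
  ∑ i ∈ Finset.range (n + 1), Kw ω α i * Kw ω α (n - i)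

/-- `M̃ₙ = Σ_{i=0}^n Mᵢ`. -/
def Mtil (ω : ℝ) (α : ℕ → ℝ) (n : ℕ) : ℕ := ∑ i ∈ Finset.range (n + 1), Mw ω α i

/-- The `n`-th approximation number of `T` (1-indexed: `approxNum T n = aₙ(T)` is the
infimum of `‖T - F‖` over bounded operators `F` of rank `< n`).  For operators between
Hilbert spaces this equals the `n`-th singular number. -/
def approxNum {X Y : Type*} [NormedAddCommGroup X] [NormedSpace ℂ X]
    [NormedAddCommGroup Y] [NormedSpace ℂ Y] (T : X →L[ℂ] Y) (n : ℕ) : ℝ :=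
  sInf {c | ∃ F : X →L[ℂ] Y, LinearMap.rank (F : X →ₗ[ℂ] Y) < (n : Cardinal) ∧ c = ‖T - F‖}

/-- The `n`-th Kolmogorov number `dₙ(T)` (1-indexed). -/
def kolNum {X Y : Type*} [NormedAddCommGroup X] [NormedSpace ℂ X]
    [NormedAddCommGroup Y] [NormedSpace ℂ Y] (T : X →L[ℂ] Y) (n : ℕ) : ℝ :=
  sInf {c | ∃ V : Submodule ℂ Y, Module.rank ℂ V < (n : Cardinal) ∧
    c = ⨆ x : {x : X // ‖x‖ ≤ 1}, ⨅ y : V, ‖T x.1 - (y : Y)‖}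

/-- The `n`-th Hilbert number `hₙ(T)` (1-indexed): the supremum of `sₙ(A ∘ T ∘ B)` over
all Hilbert spaces `K`, `H'` and all contractions `B : K → X`, `A : Y → H'`. -/
def hilbertNum {X Y : Type u} [NormedAddCommGroup X] [NormedSpace ℂ X]
    [NormedAddCommGroup Y] [NormedSpace ℂ Y] (T : X →L[ℂ] Y) (n : ℕ) : ℝ :=
  sSup {c | ∃ (K : Type u) (_ : NormedAddCommGroup K) (_ : InnerProductSpace ℂ K)
    (_ : CompleteSpace K) (H' : Type u) (_ : NormedAddCommGroup H')
    (_ : InnerProductSpace ℂ H') (_ : CompleteSpace H')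
    (B : K →L[ℂ] X) (A : Y →L[ℂ] H'), ‖B‖ ≤ 1 ∧ ‖A‖ ≤ 1 ∧
    c = approxNum ((A.comp T).comp B) n}

/-- The sequence of singular numbers of an operator, 0-indexed:
`sSeq T n = s_{n+1}(T) = a_{n+1}(T)`. -/
def sSeq {X Y : Type*} [NormedAddCommGroup X] [NormedSpace ℂ X]
    [NormedAddCommGroup Y] [NormedSpace ℂ Y] (T : X →L[ℂ] Y) : ℕ → ℝ :=
  fun n => approxNum T (n + 1)

/-- The multiplication operator `M_{a,b} : x ↦ a * x * b` on a normed algebra. -/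
def Mop {A : Type*} [NonUnitalNormedRing A] [NormedSpace ℂ A] [IsScalarTower ℂ A A]
    [SMulCommClass ℂ A A] (a b : A) : A →L[ℂ] A :=
  (ContinuousLinearMap.mul ℂ A a).comp ((ContinuousLinearMap.mul ℂ A).flip b)

open scoped InnerProductSpace

lemma aux_top {H : Type*} [NormedAddCommGroup H] [InnerProductSpace ℂ H] [CompleteSpace H]
    (A : H →L[ℂ] H) (hA : IsCompactOperator ⇑A) (h0 : A ≠ 0) :
    ∃ (e : H) (z : ℂ), ‖e‖ = 1 ∧ z ≠ 0 ∧ (∀ x, ⟪A x, A e⟫_ℂ = z * ⟪x, e⟫_ℂ) ∧ ‖A e‖ = ‖A‖ := by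
  set T : H →L[ℂ] H := (ContinuousLinearMap.adjoint A).comp A with hT
  have hTc : IsCompactOperator ⇑T := hA.clm_comp (ContinuousLinearMap.adjoint A)
  have hTn : ‖T‖ = ‖A‖ * ‖A‖ := ContinuousLinearMap.norm_adjoint_comp_self A
  have hApos : 0 < ‖A‖ := norm_pos_iff.2 h0
  have hsa : IsSelfAdjoint T := IsSelfAdjoint.star_mul_self A
  have : Nontrivial H := by
    by_contra hn
    rw [not_nontrivial_iff_subsingleton] at hn
    exact h0 (Subsingleton.elim _ _)
  obtain ⟨z, hz, hzn⟩ := spectrum.exists_nnnorm_eq_spectralRadius T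
  have hzn' : ‖z‖ = ‖A‖ * ‖A‖ := by
    rw [IsSelfAdjoint.spectralRadius_eq_nnnorm hsa] at hzn
    rw [← hTn]
    have : ‖z‖₊ = ‖T‖₊ := by exact_mod_cast hzn
    exact congrArg NNReal.toReal this
  have hz0 : z ≠ 0 := by
    rw [← norm_pos_iff, hzn']; positivity
  have hev := (hTc.hasEigenvalue_iff_mem_spectrum hz0).2 hz
  obtain ⟨v, hv⟩ := hev.exists_hasEigenvector
  have hvn : ‖v‖ ≠ 0 := norm_ne_zero_iff.2 hv.2
  have hTv : T v = z • v := hv.apply_eq_smul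
  refine ⟨((‖v‖⁻¹ : ℝ) : ℂ) • v, z, ?_, hz0, ?_, ?_⟩
  · rw [norm_smul]; simp [hvn]
  · intro x
    rw [← ContinuousLinearMap.adjoint_inner_right]
    change ⟪x, T _⟫_ℂ = _
    rw [map_smul, hTv, smul_comm, inner_smul_right]
  · have h1 : ⟪A v, A v⟫_ℂ = z * ⟪v, v⟫_ℂ := by
      rw [← ContinuousLinearMap.adjoint_inner_right]
      change ⟪v, T _⟫_ℂ = _
      rw [hTv, inner_smul_right]
    have h2 : ‖A v‖ ^ 2 = (‖A‖ * ‖v‖) ^ 2 := by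
      have := congrArg norm h1
      rw [inner_self_eq_norm_sq_to_K, inner_self_eq_norm_sq_to_K, norm_mul, hzn'] at this
      simp at this
      rw [this]; ring
    have h3 : ‖A v‖ = ‖A‖ * ‖v‖ :=
      (sq_eq_sq₀ (norm_nonneg _) (by positivity)).1 h2
    rw [map_smul, norm_smul, h3]
    simp
    field_simp

lemma approxNum_nonneg {X Y : Type*} [NormedAddCommGroup X] [NormedSpace ℂ X]
    [NormedAddCommGroup Y] [NormedSpace ℂ Y] (T : X →L[ℂ] Y) (n : ℕ) : 0 ≤ approxNum T n := by
  apply Real.sInf_nonneg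
  rintro c ⟨F, -, rfl⟩
  exact norm_nonneg _

lemma approxNum_le {X Y : Type*} [NormedAddCommGroup X] [NormedSpace ℂ X]
    [NormedAddCommGroup Y] [NormedSpace ℂ Y] (T F : X →L[ℂ] Y) (n : ℕ)
    (h : LinearMap.rank (F : X →ₗ[ℂ] Y) < (n : Cardinal)) : approxNum T n ≤ ‖T - F‖ := by
  apply csInf_le
  · refine ⟨0, ?_⟩
    rintro c ⟨F, -, rfl⟩
    exact norm_nonneg _
  · exact ⟨F, h, rfl⟩

lemma approxNum_succ_le_norm {X Y : Type*} [NormedAddCommGroup X] [NormedSpace ℂ X]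
    [NormedAddCommGroup Y] [NormedSpace ℂ Y] (T : X →L[ℂ] Y) (n : ℕ) :
    approxNum T (n + 1) ≤ ‖T‖ := by
  have := approxNum_le T 0 (n + 1) (by
    rw [ContinuousLinearMap.toLinearMap_zero, LinearMap.rank_zero]
    exact_mod_cast Nat.succ_pos n)
  simpa using this

lemma sSeq_anti {X Y : Type*} [NormedAddCommGroup X] [NormedSpace ℂ X]
    [NormedAddCommGroup Y] [NormedSpace ℂ Y] (T : X →L[ℂ] Y) {m n : ℕ} (h : m ≤ n) :
    sSeq T n ≤ sSeq T m := by
  refine le_csInf ?_ ?_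
  · refine ⟨‖T - 0‖, 0, ?_, rfl⟩
    rw [ContinuousLinearMap.toLinearMap_zero, LinearMap.rank_zero]
    exact_mod_cast Nat.succ_pos m
  · rintro c ⟨F, hF, rfl⟩
    refine approxNum_le T F _ (hF.trans_le ?_)
    exact_mod_cast Nat.succ_le_succ h

lemma aux_svd {H : Type*} [NormedAddCommGroup H] [InnerProductSpace ℂ H] [CompleteSpace H]
    (A : H →L[ℂ] H) (hA : IsCompactOperator ⇑A) (m : ℕ) (hm : ∀ i < m, 0 < sSeq A i) :
    ∃ e : ℕ → H, (∀ i < m, ‖e i‖ = 1) ∧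
      (∀ i < m, ∀ j < m, i ≠ j → ⟪e i, e j⟫_ℂ = 0) ∧
      (∀ i < m, ∀ x, ⟪x, e i⟫_ℂ = 0 → ⟪A x, A (e i)⟫_ℂ = 0) ∧
      (∀ i < m, sSeq A i ≤ ‖A (e i)‖) := by
  induction m with
  | zero => exact ⟨fun _ => 0, by simp, by simp, by simp, by simp⟩
  | succ m ih =>
    obtain ⟨e, he1, he2, he3, he4⟩ := ih (fun i hi => hm i (by omega))
    classical
    set F : H →L[ℂ] H := ∑ i ∈ Finset.range m, (innerSL ℂ (e i)).smulRight (A (e i)) with hF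
    have hFx : ∀ x, F x = ∑ i ∈ Finset.range m, ⟪e i, x⟫_ℂ • A (e i) := by
      intro x
      simp [hF]
    have hrank : LinearMap.rank (F : H →ₗ[ℂ] H) < ((m + 1 : ℕ) : Cardinal) := by
      have h1 : LinearMap.range (F : H →ₗ[ℂ] H) ≤
          Submodule.span ℂ (((Finset.range m).image (fun i => A (e i)) : Finset H) : Set H) := by
        rintro _ ⟨x, rfl⟩
        change F x ∈ _
        rw [hFx]
        refine Submodule.sum_mem _ fun i hi => Submodule.smul_mem _ _ (Submodule.subset_span ?_)
        exact Finset.mem_coe.2 (Finset.mem_image_of_mem _ hi)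
      have h2 := (Submodule.rank_mono h1).trans (rank_span_finset_le _)
      refine h2.trans_lt ?_
      have := (Finset.card_image_le (s := Finset.range m) (f := fun i => A (e i)))
      rw [Finset.card_range] at this
      exact_mod_cast Nat.lt_succ_of_le this
    set C : H →L[ℂ] H := A - F with hC
    have hFc : IsCompactOperator ⇑F := by
      have : ∀ i, IsCompactOperator ⇑((innerSL ℂ (e i)).smulRight (A (e i))) := by
        intro i
        have h : IsCompactOperator ⇑(innerSL ℂ (e i)) :=
          isCompactOperator_of_locallyCompactSpace_dom (innerSL ℂ (e i))
        exact h.clm_comp ((ContinuousLinearMap.id ℂ ℂ).smulRight (A (e i)))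
      have h2 : F ∈ compactOperator (RingHom.id ℂ) H H :=
        Submodule.sum_mem _ fun i _ => this i
      exact h2
    have hCc : IsCompactOperator ⇑C := hA.sub hFc
    have hle : sSeq A m ≤ ‖C‖ := approxNum_le A F (m + 1) hrank
    have hC0 : C ≠ 0 := by
      rw [← norm_pos_iff]; exact (hm m (by omega)).trans_le hle
    obtain ⟨f, z, hf1, hz, hf2, hf3⟩ := aux_top C hCc hC0
    have hCe : ∀ i < m, C (e i) = 0 := by
      intro i hi
      rw [hC, sub_apply, hFx, Finset.sum_eq_single i]
      · rw [inner_self_eq_norm_sq_to_K, he1 i hi]; simp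
      · intro j hj hji
        rw [he2 j (Finset.mem_range.1 hj) i hi hji, zero_smul]
      · intro h; exact absurd (Finset.mem_range.2 hi) h
    have hef : ∀ i < m, ⟪e i, f⟫_ℂ = 0 := by
      intro i hi
      have := hf2 (e i)
      rw [hCe i hi, inner_zero_left] at this
      exact (mul_eq_zero.1 this.symm).resolve_left hz
    have hCf : C f = A f := by
      rw [hC, sub_apply, hFx, Finset.sum_eq_zero, sub_zero]
      intro i hi
      rw [hef i (Finset.mem_range.1 hi), zero_smul]
    have hAf : ∀ i < m, ⟪A (e i), A f⟫_ℂ = 0 := by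
      intro i hi
      rw [inner_eq_zero_symm]
      exact he3 i hi f (inner_eq_zero_symm.1 (hef i hi))
    have hff : ∀ x, ⟪x, f⟫_ℂ = 0 → ⟪A x, A f⟫_ℂ = 0 := by
      intro x hx
      have h1 : A x = C x + F x := by simp [hC]
      rw [h1, inner_add_left, ← hCf, hf2, hx, hCf, hFx, sum_inner, Finset.sum_eq_zero]
      · simp
      · intro i hi
        rw [inner_smul_left, hAf i (Finset.mem_range.1 hi), mul_zero]
    refine ⟨Function.update e m f, ?_, ?_, ?_, ?_⟩
    · intro i hi
      rcases eq_or_ne i m with rfl | h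
      · simpa using hf1
      · rw [Function.update_of_ne h]; exact he1 i (by omega)
    · intro i hi j hj hij
      rcases eq_or_ne i m with rfl | h
      · rw [Function.update_self, Function.update_of_ne hij.symm, inner_eq_zero_symm]
        exact hef j (by omega)
      · rcases eq_or_ne j m with rfl | h'
        · rw [Function.update_self, Function.update_of_ne h]
          exact hef i (by omega)
        · rw [Function.update_of_ne h, Function.update_of_ne h']
          exact he2 i (by omega) j (by omega) hij
    · intro i hi
      rcases eq_or_ne i m with rfl | h
      · simpa using hff
      · rw [Function.update_of_ne h]; exact he3 i (by omega)
    · intro i hi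
      rcases eq_or_ne i m with rfl | h
      · rw [Function.update_self, ← hCf, hf3]; exact hle
      · rw [Function.update_of_ne h]; exact he4 i (by omega)

lemma aux_bessel {H : Type*} [NormedAddCommGroup H] [InnerProductSpace ℂ H]
    (e : ℕ → H) (m : ℕ) (he1 : ∀ i < m, ‖e i‖ = 1)
    (he2 : ∀ i < m, ∀ j < m, i ≠ j → ⟪e i, e j⟫_ℂ = 0) (x : H) :
    ∑ i ∈ Finset.range m, ‖⟪e i, x⟫_ℂ‖ ^ 2 ≤ ‖x‖ ^ 2 := by
  have ho : Orthonormal ℂ (fun i : Fin m => e i) :=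
    ⟨fun i => he1 i i.2, fun i j hij => he2 i i.2 j j.2 (fun h => hij (Fin.ext h))⟩
  rw [Finset.sum_range]
  exact ho.sum_inner_products_le x

lemma aux_select (α β : ℕ → ℂ) (a b : ℝ) (ha : ∀ i, ‖α i‖ ≤ a) (hb : ∀ i, ‖β i‖ ≤ b)
    (n : ℕ) (ε : ℝ) (hε : 0 < ε) :
    ∃ F : Finset (ℕ × ℕ), F.card = n + 1 ∧
      ∀ p ∈ F, tensorSeq α β n - ε < ‖α p.1‖ * ‖β p.2‖ := by
  have ha0 : 0 ≤ a := (norm_nonneg _).trans (ha 0)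
  have hbdd : ∀ k, BddAbove
      ((fun F : Finset (ℕ × ℕ) => ∑ p ∈ F, ‖α p.1‖ * ‖β p.2‖) '' {F | F.card = k}) := by
    intro k
    refine ⟨k * (a * b), ?_⟩
    rintro _ ⟨F, hF, rfl⟩
    have : ∑ p ∈ F, ‖α p.1‖ * ‖β p.2‖ ≤ F.card • (a * b) :=
      Finset.sum_le_card_nsmul _ _ _ fun p _ =>
        mul_le_mul (ha _) (hb _) (norm_nonneg _) ha0
    simp only [Set.mem_ofPred_eq] at hF
    rw [hF, nsmul_eq_mul] at this
    exact this
  have hne : ((fun F : Finset (ℕ × ℕ) => ∑ p ∈ F, ‖α p.1‖ * ‖β p.2‖) ''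
      {F | F.card = n + 1}).Nonempty := by
    obtain ⟨F, hF⟩ := Infinite.exists_subset_card_eq (ℕ × ℕ) (n + 1)
    exact ⟨_, F, hF, rfl⟩
  obtain ⟨_, ⟨F, hF, rfl⟩, hlt⟩ := exists_lt_of_lt_csSup hne
    (show tensorSum α β (n + 1) - ε < _ from sub_lt_self _ hε)
  refine ⟨F, hF, fun p hp => ?_⟩
  have h1 : ∑ q ∈ F.erase p, ‖α q.1‖ * ‖β q.2‖ ≤ tensorSum α β n := by
    refine le_csSup (hbdd n) ⟨F.erase p, ?_, rfl⟩
    simp only [Set.mem_ofPred_eq] at hF ⊢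
    rw [Finset.card_erase_of_mem hp, hF]; rfl
  have h2 := Finset.add_sum_erase F (fun q => ‖α q.1‖ * ‖β q.2‖) hp
  simp only at h2 hlt
  rw [tensorSeq]
  linarith

lemma aux_lower {K : Type*} [NormedAddCommGroup K] [InnerProductSpace ℂ K]
    [FiniteDimensional ℂ K] (D : K →L[ℂ] K) (n : ℕ) (hn : Module.finrank ℂ K = n + 1) (c : ℝ)
    (hD : ∀ x, c * ‖x‖ ≤ ‖D x‖) : c ≤ approxNum D (n + 1) := by
  refine le_csInf ?_ ?_
  · refine ⟨‖D - 0‖, 0, ?_, rfl⟩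
    rw [ContinuousLinearMap.toLinearMap_zero, LinearMap.rank_zero]
    exact_mod_cast Nat.succ_pos n
  · rintro _ ⟨G, hG, rfl⟩
    have hker : ∃ x : K, x ≠ 0 ∧ G x = 0 := by
      by_contra! hcon
      have hinj : Function.Injective (G : K →ₗ[ℂ] K) := by
        rw [← LinearMap.ker_eq_bot, LinearMap.ker_eq_bot']
        intro x hx
        by_contra h
        exact hcon x h hx
      have h1 := rank_range_of_injective _ hinj
      rw [LinearMap.rank, h1, ← Module.finrank_eq_rank, hn] at hG
      exact lt_irrefl _ hG
    obtain ⟨x, hx, hGx⟩ := hker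
    have h1 := (D - G).le_opNorm x
    rw [sub_apply, hGx, sub_zero] at h1
    exact le_of_mul_le_mul_right ((hD x).trans h1) (norm_pos_iff.2 hx)

/-- The contraction `ℓ²(ι) → B(H)`. -/
def auxS {H : Type*} [NormedAddCommGroup H] [InnerProductSpace ℂ H]
    {ι : Type*} [Fintype ι] (e v : ι → H) : EuclideanSpace ℂ ι →L[ℂ] (H →L[ℂ] H) :=
  ∑ p, (EuclideanSpace.proj p : EuclideanSpace ℂ ι →L[ℂ] ℂ).smulRight
    ((innerSL ℂ (v p)).smulRight (e p))

lemma auxS_apply {H : Type*} [NormedAddCommGroup H] [InnerProductSpace ℂ H]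
    {ι : Type*} [Fintype ι] (e v : ι → H) (x : EuclideanSpace ℂ ι) (h : H) :
    auxS e v x h = ∑ p, x p • ⟪v p, h⟫_ℂ • e p := by
  simp [auxS]

lemma auxS_norm {H : Type*} [NormedAddCommGroup H] [InnerProductSpace ℂ H]
    {ι : Type*} [Fintype ι] (e v : ι → H)
    (hb : ∀ y h : H, ∑ p, ‖⟪e p, y⟫_ℂ‖ ^ 2 * ‖⟪v p, h⟫_ℂ‖ ^ 2 ≤ (‖y‖ * ‖h‖) ^ 2) :
    ‖auxS e v‖ ≤ 1 := by
  refine ContinuousLinearMap.opNorm_le_bound₂ _ zero_le_one fun x h => ?_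
  set w := auxS e v x h with hw
  have h1 : ‖w‖ ^ 2 ≤ ∑ p, ‖x p‖ * (‖⟪e p, w⟫_ℂ‖ * ‖⟪v p, h⟫_ℂ‖) := by
    have : ((‖w‖ ^ 2 : ℝ) : ℂ) = ∑ p, x p * (⟪v p, h⟫_ℂ * ⟪w, e p⟫_ℂ) := by
      have h2 : ⟪w, w⟫_ℂ = ⟪w, auxS e v x h⟫_ℂ := rfl
      rw [auxS_apply, inner_sum, inner_self_eq_norm_sq_to_K] at h2
      simp only [inner_smul_right] at h2
      push_cast
      exact h2
    have h3 := congrArg norm this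
    rw [Complex.norm_real, Real.norm_of_nonneg (by positivity)] at h3
    rw [h3]
    refine (norm_sum_le _ _).trans (Finset.sum_le_sum fun p _ => ?_)
    rw [norm_mul, norm_mul, norm_inner_symm w, mul_comm ‖⟪v p, h⟫_ℂ‖]
  have h2 : (∑ p, ‖x p‖ * (‖⟪e p, w⟫_ℂ‖ * ‖⟪v p, h⟫_ℂ‖)) ^ 2 ≤ (‖x‖ * (‖w‖ * ‖h‖)) ^ 2 := by
    refine (Finset.sum_mul_sq_le_sq_mul_sq _ _ _).trans ?_
    rw [mul_pow ‖x‖, EuclideanSpace.norm_sq_eq]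
    refine mul_le_mul_of_nonneg_left ?_ (by positivity)
    simpa only [mul_pow] using hb w h
  have h3 := abs_le_of_sq_le_sq h2 (by positivity)
  have h4 : ‖w‖ * ‖w‖ ≤ ‖w‖ * (‖x‖ * ‖h‖) := by
    have := h1.trans ((le_abs_self _).trans h3); nlinarith
  rw [one_mul]
  rcases (norm_nonneg w).eq_or_lt with h0 | h0
  · rw [← h0]; positivity
  · exact le_of_mul_le_mul_left h4 h0

/-- The map `B(H) → ℓ²(ι)`, `Y ↦ (⟪f p, Y (u p)⟫)_p`. -/
def auxR {H : Type*} [NormedAddCommGroup H] [InnerProductSpace ℂ H]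
    {ι : Type*} [Fintype ι] (f u : ι → H) : (H →L[ℂ] H) →L[ℂ] EuclideanSpace ℂ ι :=
  ((EuclideanSpace.equiv ι ℂ).symm : (ι → ℂ) →L[ℂ] EuclideanSpace ℂ ι).comp
    (ContinuousLinearMap.pi fun p =>
      (innerSL ℂ (f p)).comp (ContinuousLinearMap.apply ℂ H (u p)))

lemma auxR_apply {H : Type*} [NormedAddCommGroup H] [InnerProductSpace ℂ H]
    {ι : Type*} [Fintype ι] (f u : ι → H) (Y : H →L[ℂ] H) (p : ι) :
    auxR f u Y p = ⟪f p, Y (u p)⟫_ℂ := by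
  simp [auxR]

lemma auxR_norm {H : Type*} [NormedAddCommGroup H] [InnerProductSpace ℂ H]
    {ι : Type*} [Fintype ι] (f u : ι → H) (hf : ∀ p, ‖f p‖ = 1) (hu : ∀ p, ‖u p‖ = 1) :
    ‖auxR f u‖ ≤ Real.sqrt (Fintype.card ι) := by
  refine ContinuousLinearMap.opNorm_le_bound _ (Real.sqrt_nonneg _) fun Y => ?_
  have h1 : ‖auxR f u Y‖ ^ 2 ≤ Fintype.card ι * ‖Y‖ ^ 2 := by
    rw [EuclideanSpace.norm_sq_eq]
    have : ∀ p ∈ Finset.univ, ‖auxR f u Y p‖ ^ 2 ≤ ‖Y‖ ^ 2 := by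
      intro p _
      rw [auxR_apply]
      refine pow_le_pow_left₀ (norm_nonneg _) ?_ 2
      refine (norm_inner_le_norm _ _).trans ?_
      have := Y.le_opNorm (u p)
      rw [hu, mul_one] at this
      rwa [hf, one_mul]
    have h2 := Finset.sum_le_card_nsmul _ _ _ this
    rwa [nsmul_eq_mul] at h2
  rw [← Real.sqrt_sq (norm_nonneg Y), ← Real.sqrt_mul (by positivity)]
  exact Real.le_sqrt_of_sq_le h1

/-- Let `A, B` be compact operators on a Hilbert space `H`.  Then
`hₙ(M_{A,B}) ≥ (s(A)⊗s(B))ₙ / √n` for every `n ≥ 1`. -/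
theorem hilbertNum_Mop_ge {H : Type u} [NormedAddCommGroup H]
    [InnerProductSpace ℂ H] [CompleteSpace H]
    (A B : H →L[ℂ] H) (hA : IsCompactOperator ⇑A) (hB : IsCompactOperator ⇑B) :
    ∀ n : ℕ,
      tensorSeq (toC (sSeq A)) (toC (sSeq B)) n / Real.sqrt ((n : ℝ) + 1) ≤
        hilbertNum (Mop A B) (n + 1) := by
  intro n
  have hsq : 0 < Real.sqrt ((n : ℝ) + 1) := Real.sqrt_pos.2 (by positivity)
  have hnn : 0 ≤ hilbertNum (Mop A B) (n + 1) := by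
    apply Real.sSup_nonneg
    rintro c ⟨K, _, _, _, H', _, _, _, S, R, -, -, rfl⟩
    exact approxNum_nonneg _ _
  set t := tensorSeq (toC (sSeq A)) (toC (sSeq B)) n with ht
  rw [div_le_iff₀ hsq]
  refine le_of_forall_pos_sub_le fun ε hε => ?_
  rcases le_or_gt (t - ε) 0 with hneg | hpos
  · exact hneg.trans (by positivity)
  have hnorm : ∀ (T : H →L[ℂ] H) i, ‖toC (sSeq T) i‖ = sSeq T i := by
    intro T i
    rw [toC, Complex.norm_real, Real.norm_of_nonneg (show 0 ≤ sSeq T i from approxNum_nonneg _ _)]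
  obtain ⟨F, hFc, hF⟩ := aux_select (toC (sSeq A)) (toC (sSeq B)) ‖A‖ ‖B‖
    (fun i => by rw [hnorm]; exact approxNum_succ_le_norm _ _)
    (fun i => by rw [hnorm]; exact approxNum_succ_le_norm _ _) n ε hε
  simp only [hnorm] at hF
  have hA0 : ∀ i, 0 ≤ sSeq A i := fun i => approxNum_nonneg _ _
  have hB0 : ∀ i, 0 ≤ sSeq B i := fun i => approxNum_nonneg _ _
  set ma := F.sup (fun p => p.1 + 1) with hma
  set mb := F.sup (fun p => p.2 + 1) with hmb
  have hpa : ∀ i < ma, 0 < sSeq A i := by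
    intro i hi
    obtain ⟨p, hp, hlt⟩ := Finset.lt_sup_iff.1 hi
    have h1 := hpos.trans (hF p hp)
    exact (pos_of_mul_pos_left h1 (hB0 _)).trans_le (sSeq_anti A (by omega))
  have hpb : ∀ i < mb, 0 < sSeq B i := by
    intro i hi
    obtain ⟨p, hp, hlt⟩ := Finset.lt_sup_iff.1 hi
    have h1 := hpos.trans (hF p hp)
    exact (pos_of_mul_pos_right h1 (hA0 _)).trans_le (sSeq_anti B (by omega))
  have hFa : ∀ p ∈ F, p.1 < ma := fun p hp =>
    Finset.lt_sup_iff.2 ⟨p, hp, Nat.lt_succ_self _⟩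
  have hFb : ∀ p ∈ F, p.2 < mb := fun p hp =>
    Finset.lt_sup_iff.2 ⟨p, hp, Nat.lt_succ_self _⟩
  obtain ⟨e, he1, he2, he3, he4⟩ := aux_svd A hA ma hpa
  obtain ⟨u, hu1, hu2, hu3, hu4⟩ := aux_svd B hB mb hpb
  have hAe : ∀ i < ma, 0 < ‖A (e i)‖ := fun i hi => (hpa i hi).trans_le (he4 i hi)
  have hBu : ∀ i < mb, 0 < ‖B (u i)‖ := fun i hi => (hpb i hi).trans_le (hu4 i hi)
  set f : ℕ → H := fun i => ((‖A (e i)‖⁻¹ : ℝ) : ℂ) • A (e i) with hf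
  set v : ℕ → H := fun i => ((‖B (u i)‖⁻¹ : ℝ) : ℂ) • B (u i) with hv
  have hf1 : ∀ i < ma, ‖f i‖ = 1 := by
    intro i hi
    have := (hAe i hi).ne'
    rw [hf]; simp only [norm_smul]; simp [this]
  have hv1 : ∀ i < mb, ‖v i‖ = 1 := by
    intro i hi
    have := (hBu i hi).ne'
    rw [hv]; simp only [norm_smul]; simp [this]
  have hfA : ∀ i < ma, ∀ j < ma, ⟪f i, A (e j)⟫_ℂ = if i = j then (‖A (e i)‖ : ℂ) else 0 := by
    intro i hi j hj
    simp only [hf, inner_smul_left]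
    split_ifs with h
    · subst h
      have : (‖A (e i)‖ : ℂ) ≠ 0 := by exact_mod_cast (hAe i hi).ne'
      rw [inner_self_eq_norm_sq_to_K]
      simp
      field_simp
    · rw [he3 j hj (e i) (he2 i hi j hj h), mul_zero]
  have hvB : ∀ i < mb, ∀ j < mb, ⟪v i, B (u j)⟫_ℂ = if i = j then (‖B (u i)‖ : ℂ) else 0 := by
    intro i hi j hj
    simp only [hv, inner_smul_left]
    split_ifs with h
    · subst h
      have : (‖B (u i)‖ : ℂ) ≠ 0 := by exact_mod_cast (hBu i hi).ne'
      rw [inner_self_eq_norm_sq_to_K]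
      simp
      field_simp
    · rw [hu3 j hj (u i) (hu2 i hi j hj h), mul_zero]
  have hv2 : ∀ i < mb, ∀ j < mb, i ≠ j → ⟪v i, v j⟫_ℂ = 0 := by
    intro i hi j hj hij
    have : v j = ((‖B (u j)‖⁻¹ : ℝ) : ℂ) • B (u j) := rfl
    rw [this, inner_smul_right, hvB i hi j hj, if_neg hij, mul_zero]
  let ι : Type u := ULift.{u} F
  have hcard : Fintype.card ι = n + 1 := by
    rw [Fintype.card_ulift, Fintype.card_coe, hFc]
  let S : EuclideanSpace ℂ ι →L[ℂ] (H →L[ℂ] H) :=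
    auxS (fun p : ι => e p.down.1.1) (fun p : ι => v p.down.1.2)
  let R : (H →L[ℂ] H) →L[ℂ] EuclideanSpace ℂ ι :=
    auxR (fun p : ι => f p.down.1.1) (fun p : ι => u p.down.1.2)
  have hS : ‖S‖ ≤ 1 := by
    refine auxS_norm _ _ fun y h => ?_
    have h1 : ∑ p : ι, ‖⟪e p.down.1.1, y⟫_ℂ‖ ^ 2 * ‖⟪v p.down.1.2, h⟫_ℂ‖ ^ 2 =
        ∑ p ∈ F, ‖⟪e p.1, y⟫_ℂ‖ ^ 2 * ‖⟪v p.2, h⟫_ℂ‖ ^ 2 := by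
      rw [← Finset.sum_coe_sort F]
      exact Fintype.sum_equiv Equiv.ulift _ _ (fun p => rfl)
    rw [h1]
    have h2 : F ⊆ Finset.range ma ×ˢ Finset.range mb := by
      intro p hp
      rw [Finset.mem_product, Finset.mem_range, Finset.mem_range]
      exact ⟨hFa p hp, hFb p hp⟩
    refine (Finset.sum_le_sum_of_subset_of_nonneg h2 fun _ _ _ => by positivity).trans ?_
    rw [Finset.sum_product]
    simp only
    rw [← Finset.sum_mul_sum, mul_pow]
    exact mul_le_mul (aux_bessel e ma he1 he2 y) (aux_bessel v mb hv1 hv2 h)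
      (Finset.sum_nonneg fun _ _ => by positivity) (by positivity)
  have hR : ‖R‖ ≤ Real.sqrt ((n : ℝ) + 1) := by
    have := auxR_norm (fun p : ι => f p.down.1.1) (fun p : ι => u p.down.1.2)
      (fun p => hf1 _ (hFa _ p.down.2)) (fun p => hu1 _ (hFb _ p.down.2))
    rw [hcard] at this
    exact_mod_cast this
  let R' : (H →L[ℂ] H) →L[ℂ] EuclideanSpace ℂ ι := (((Real.sqrt ((n : ℝ) + 1))⁻¹ : ℝ) : ℂ) • R
  have hR' : ‖R'‖ ≤ 1 := by
    change ‖(((Real.sqrt ((n : ℝ) + 1))⁻¹ : ℝ) : ℂ) • R‖ ≤ 1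
    rw [norm_smul, Complex.norm_real, Real.norm_of_nonneg (by positivity), inv_mul_le_iff₀ hsq,
      mul_one]
    exact hR
  have hdiag : ∀ (x : EuclideanSpace ℂ ι) (p : ι), R (Mop A B (S x)) p =
      x p * ((‖A (e p.down.1.1)‖ : ℂ) * ‖B (u p.down.1.2)‖) := by
    intro x p
    change auxR _ _ _ p = _
    rw [auxR_apply]
    change ⟪f p.down.1.1, A (auxS _ _ x (B (u p.down.1.2)))⟫_ℂ = _
    rw [auxS_apply, map_sum, inner_sum, Finset.sum_eq_single p]
    · rw [map_smul, map_smul, inner_smul_right, inner_smul_right,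
        hfA _ (hFa _ p.down.2) _ (hFa _ p.down.2), hvB _ (hFb _ p.down.2) _ (hFb _ p.down.2),
        if_pos rfl, if_pos rfl]
      ring
    · intro q _ hq
      rw [map_smul, map_smul, inner_smul_right, inner_smul_right,
        hfA _ (hFa _ p.down.2) _ (hFa _ q.down.2), hvB _ (hFb _ q.down.2) _ (hFb _ p.down.2)]
      by_cases h1 : p.down.1.1 = q.down.1.1
      · have h2 : q.down.1.2 ≠ p.down.1.2 := fun h2 =>
          hq (ULift.ext _ _ (Subtype.ext (Prod.ext h1.symm h2)))
        rw [if_neg h2]; simp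
      · rw [if_neg h1]; simp
    · intro h; exact absurd (Finset.mem_univ _) h
  have hlow : ∀ x : EuclideanSpace ℂ ι, (t - ε) * ‖x‖ ≤ ‖R (Mop A B (S x))‖ := by
    intro x
    refine le_of_abs_le (abs_le_of_sq_le_sq ?_ (norm_nonneg _))
    rw [mul_pow, EuclideanSpace.norm_sq_eq, EuclideanSpace.norm_sq_eq, Finset.mul_sum]
    refine Finset.sum_le_sum fun p _ => ?_
    rw [hdiag, norm_mul, mul_pow, mul_comm]
    refine mul_le_mul_of_nonneg_left ?_ (by positivity)
    refine pow_le_pow_left₀ hpos.le ?_ 2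
    rw [norm_mul, Complex.norm_real, Complex.norm_real, norm_norm, norm_norm]
    exact (hF _ p.down.2).le.trans (mul_le_mul (he4 _ (hFa _ p.down.2)) (hu4 _ (hFb _ p.down.2))
      (hB0 _) (norm_nonneg _))
  have happ : (t - ε) / Real.sqrt ((n : ℝ) + 1) ≤
      approxNum ((R'.comp (Mop A B)).comp S) (n + 1) := by
    refine aux_lower _ n (by rw [finrank_euclideanSpace, hcard]) _ fun x => ?_
    change _ ≤ ‖(((Real.sqrt ((n : ℝ) + 1))⁻¹ : ℝ) : ℂ) • R (Mop A B (S x))‖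
    rw [norm_smul, Complex.norm_real, Real.norm_of_nonneg (by positivity), div_mul_eq_mul_div,
      div_eq_inv_mul]
    exact mul_le_mul_of_nonneg_left (hlow x) (by positivity)
  rw [← div_le_iff₀ hsq]
  refine happ.trans (le_csSup ?_ ?_)
  · refine ⟨‖Mop A B‖, ?_⟩
    rintro c ⟨K, _, _, _, H', _, _, _, S, R, hS, hR, rfl⟩
    refine (approxNum_succ_le_norm _ _).trans ?_
    refine (ContinuousLinearMap.opNorm_comp_le _ _).trans ?_
    refine (mul_le_of_le_one_right (norm_nonneg _) hS).trans ?_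
    refine (ContinuousLinearMap.opNorm_comp_le _ _).trans ?_
    exact mul_le_of_le_one_left (norm_nonneg _) hR
  · exact ⟨EuclideanSpace ℂ ι, inferInstance, inferInstance, inferInstance,
      EuclideanSpace ℂ ι, inferInstance, inferInstance, inferInstance, S, R', hS, hR', rfl⟩
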